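/- arXiv:math/0505376 — 6 statements merged into one kernel-verified Lean document; each statement's English description precedes it below -/
import Mathlib

section
/- Let l, m : ℝ² → ℝ be smooth functions of (x,z). Then the following are equivalent: (i) for every x, z and every y ≠ 0, both expressions (l_{xxx} − 3 l l_x + l_z)·y + (− l m_{xx} + m_{xz} − 3 l_x m_x − 2 m l_{xx} − l_{xx}) − (− m m_z + m l m_x + l_x m + 2 l_x m²)/y and (l_x − m_z + 2 l_x m + l m_x)/y vanish; (ii) l and m satisfy the two equations l_{xxx} − 3 l l_x + l_z = 0 and l_x − m_z + 2 l_x m + l m_x = 0. (These two expressions are the components R₁₃₁₃ and R₁₃₂₃ of the curvature tensor of the metric ds² = y² dx² + 2(l y² + m) dx dz + 2 dy dz + (l² y² − 2 l_x y + 2 l m + 2 l) dz², so (ii) characterizes flatness of this metric.) -/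
/-- Partial derivative in the first variable of a function of (x, z). -/
noncomputable def dx (f : ℝ → ℝ → ℝ) : ℝ → ℝ → ℝ :=
  fun x z => deriv (fun t => f t z) x

/-- Partial derivative in the second variable of a function of (x, z). -/
noncomputable def dz (f : ℝ → ℝ → ℝ) : ℝ → ℝ → ℝ :=
  fun x z => deriv (fun t => f x t) z

theorem hasDerivAt_fst_of_differentiable {f : ℝ → ℝ → ℝ}
    (hf : Differentiable ℝ (fun p : ℝ × ℝ => f p.1 p.2)) (x z : ℝ) :
    HasDerivAt (fun t => f t z) (fderiv ℝ (fun p : ℝ × ℝ => f p.1 p.2) (x, z) (1, 0)) x :=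
  HasFDerivAt.comp_hasDerivAt (l := fun p : ℝ × ℝ => f p.1 p.2) (f := fun t => (t, z)) x
    (hf (x, z)).hasFDerivAt ((hasDerivAt_id' x).prodMk (hasDerivAt_const x z))

theorem hasDerivAt_snd_of_differentiable {f : ℝ → ℝ → ℝ}
    (hf : Differentiable ℝ (fun p : ℝ × ℝ => f p.1 p.2)) (x z : ℝ) :
    HasDerivAt (fun t => f x t) (fderiv ℝ (fun p : ℝ × ℝ => f p.1 p.2) (x, z) (0, 1)) z :=
  HasFDerivAt.comp_hasDerivAt (l := fun p : ℝ × ℝ => f p.1 p.2) (f := fun t => (x, t)) z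
    (hf (x, z)).hasFDerivAt ((hasDerivAt_const z x).prodMk (hasDerivAt_id' z))

theorem dx_eq_fderiv {f : ℝ → ℝ → ℝ}
    (hf : Differentiable ℝ (fun p : ℝ × ℝ => f p.1 p.2)) (x z : ℝ) :
    dx f x z = fderiv ℝ (fun p : ℝ × ℝ => f p.1 p.2) (x, z) (1, 0) :=
  (hasDerivAt_fst_of_differentiable hf x z).deriv

theorem dz_eq_fderiv {f : ℝ → ℝ → ℝ}
    (hf : Differentiable ℝ (fun p : ℝ × ℝ => f p.1 p.2)) (x z : ℝ) :
    dz f x z = fderiv ℝ (fun p : ℝ × ℝ => f p.1 p.2) (x, z) (0, 1) :=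
  (hasDerivAt_snd_of_differentiable hf x z).deriv

theorem hasDerivAt_dx {f : ℝ → ℝ → ℝ}
    (hf : Differentiable ℝ (fun p : ℝ × ℝ => f p.1 p.2)) (x z : ℝ) :
    HasDerivAt (fun t => f t z) (dx f x z) x :=
  (hasDerivAt_fst_of_differentiable hf x z).differentiableAt.hasDerivAt

theorem contDiff_dx {f : ℝ → ℝ → ℝ}
    (hf : ContDiff ℝ (⊤ : ℕ∞) (fun p : ℝ × ℝ => f p.1 p.2)) :
    ContDiff ℝ (⊤ : ℕ∞) (fun p : ℝ × ℝ => dx f p.1 p.2) := by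
  simp_rw [dx_eq_fderiv (hf.differentiable (by simp))]
  exact (hf.fderiv_right (m := (⊤ : ℕ∞)) (by simp)).clm_apply contDiff_const

theorem contDiff_dz {f : ℝ → ℝ → ℝ}
    (hf : ContDiff ℝ (⊤ : ℕ∞) (fun p : ℝ × ℝ => f p.1 p.2)) :
    ContDiff ℝ (⊤ : ℕ∞) (fun p : ℝ × ℝ => dz f p.1 p.2) := by
  simp_rw [dz_eq_fderiv (hf.differentiable (by simp))]
  exact (hf.fderiv_right (m := (⊤ : ℕ∞)) (by simp)).clm_apply contDiff_const

/-- Mixed partial derivatives of a smooth function commute. -/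
theorem dx_dz_comm {f : ℝ → ℝ → ℝ}
    (hf : ContDiff ℝ (⊤ : ℕ∞) (fun p : ℝ × ℝ => f p.1 p.2)) (x z : ℝ) :
    dx (dz f) x z = dz (dx f) x z := by
  have hd : Differentiable ℝ (fun p : ℝ × ℝ => f p.1 p.2) := hf.differentiable (by simp)
  have hd' : DifferentiableAt ℝ (fderiv ℝ (fun p : ℝ × ℝ => f p.1 p.2)) (x, z) :=
    (hf.fderiv_right (m := (⊤ : ℕ∞)) (by simp)).differentiable (by simp) _
  rw [dx_eq_fderiv ((contDiff_dz hf).differentiable (by simp)),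
    dz_eq_fderiv ((contDiff_dx hf).differentiable (by simp))]
  simp_rw [dx_eq_fderiv hd, dz_eq_fderiv hd]
  rw [fderiv_clm_apply hd' (differentiableAt_const _),
    fderiv_clm_apply hd' (differentiableAt_const _)]
  have hs : IsSymmSndFDerivAt ℝ (fun p : ℝ × ℝ => f p.1 p.2) (x, z) :=
    hf.contDiffAt.isSymmSndFDerivAt (by
      rw [minSmoothness_of_isRCLikeNormedField]
      exact WithTop.coe_le_coe.2 (le_top : (2 : ℕ∞) ≤ ⊤))
  simpa using hs.eq (1, 0) (0, 1)

/-- Differentiating the second equation of the system in `x`. -/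
theorem dx_equation_eq_zero {l m : ℝ → ℝ → ℝ}
    (hl : ContDiff ℝ (⊤ : ℕ∞) (fun p : ℝ × ℝ => l p.1 p.2))
    (hm : ContDiff ℝ (⊤ : ℕ∞) (fun p : ℝ × ℝ => m p.1 p.2))
    (h : ∀ x z, dx l x z - dz m x z + 2 * dx l x z * m x z + l x z * dx m x z = 0)
    (x z : ℝ) :
    - l x z * dx (dx m) x z + dz (dx m) x z - 3 * dx l x z * dx m x z
      - 2 * m x z * dx (dx l) x z - dx (dx l) x z = 0 := by
  have hasDeriv {f : ℝ → ℝ → ℝ} (hf : ContDiff ℝ (⊤ : ℕ∞) (fun p : ℝ × ℝ => f p.1 p.2)) :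
      HasDerivAt (fun t => f t z) (dx f x z) x :=
    hasDerivAt_dx (hf.differentiable (by simp)) x z
  have hE := (((hasDeriv (contDiff_dx hl)).sub (hasDeriv (contDiff_dz hm))).add
    (((hasDeriv (contDiff_dx hl)).const_mul 2).mul (hasDeriv hm))).add
    ((hasDeriv hl).mul (hasDeriv (contDiff_dx hm)))
  have h0 : HasDerivAt (fun _ : ℝ => (0 : ℝ)) _ x :=
    hE.congr_of_eventuallyEq (Filter.Eventually.of_forall fun t => (h t z).symm)
  have := h0.unique (hasDerivAt_const x 0)
  rw [dx_dz_comm hm] at this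
  linear_combination -this

/-- For smooth `l, m : ℝ² → ℝ`, the curvature components `R₁₃₁₃` and `R₁₃₂₃` of the
metric `ds² = y² dx² + 2(l y² + m) dx dz + 2 dy dz + (l² y² − 2 l_x y + 2 l m + 2 l) dz²`
vanish for every `x, z` and every `y ≠ 0` if and only if `l, m` satisfy the system
`l_{xxx} − 3 l l_x + l_z = 0` and `l_x − m_z + 2 l_x m + l m_x = 0`. -/
theorem flatness_iff_kdv_system (l m : ℝ → ℝ → ℝ)
    (hl : ContDiff ℝ (⊤ : ℕ∞) (fun p : ℝ × ℝ => l p.1 p.2))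
    (hm : ContDiff ℝ (⊤ : ℕ∞) (fun p : ℝ × ℝ => m p.1 p.2)) :
    (∀ x z y : ℝ, y ≠ 0 →
      (dx (dx (dx l)) x z - 3 * l x z * dx l x z + dz l x z) * y
        + (- l x z * dx (dx m) x z + dz (dx m) x z - 3 * dx l x z * dx m x z
            - 2 * m x z * dx (dx l) x z - dx (dx l) x z)
        - (- m x z * dz m x z + m x z * l x z * dx m x z + dx l x z * m x z
            + 2 * dx l x z * (m x z) ^ 2) / y = 0 ∧
      (dx l x z - dz m x z + 2 * dx l x z * m x z + l x z * dx m x z) / y = 0)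
    ↔ (∀ x z : ℝ,
      dx (dx (dx l)) x z - 3 * l x z * dx l x z + dz l x z = 0 ∧
      dx l x z - dz m x z + 2 * dx l x z * m x z + l x z * dx m x z = 0) := by
  constructor
  · intro h
    have hE : ∀ x z, dx l x z - dz m x z + 2 * dx l x z * m x z + l x z * dx m x z = 0 :=
      fun x z => by simpa using (h x z 1 one_ne_zero).2
    refine fun x z => ⟨?_, hE x z⟩
    have h1 := (h x z 1 one_ne_zero).1
    rw [dx_equation_eq_zero hl hm hE x z] at h1
    linear_combination h1 + m x z * hE x z
  · intro h x z y _
    have hE := fun x z => (h x z).2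
    have hC : - m x z * dz m x z + m x z * l x z * dx m x z + dx l x z * m x z
        + 2 * dx l x z * (m x z) ^ 2 = 0 := by
      linear_combination m x z * hE x z
    rw [(h x z).1, hE x z, dx_equation_eq_zero hl hm hE x z, hC]
    simp
end

section
/- Let F : ℝ → ℝ be continuously differentiable, and define on the set {(x,z) ∈ ℝ² : x ≠ 0, z ≠ 0} the functions l(x,z) = −x/(3z) and m(x,z) = −1/2 + F(z/x³)·x^{−2}. Then l and m satisfy the system l_{xxx} − 3 l l_x + l_z = 0 and l_x − m_z + 2 l_x m + l m_x = 0 at every point of this set. -/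
/-- For `F : ℝ → ℝ` continuously differentiable, the functions `l(x,z) = −x/(3z)` and
`m(x,z) = −1/2 + F(z/x³)·x^{−2}` satisfy the system `l_{xxx} − 3 l l_x + l_z = 0`,
`l_x − m_z + 2 l_x m + l m_x = 0` at every point with `x ≠ 0`, `z ≠ 0`. -/
theorem kdv_similarity_solution (F : ℝ → ℝ) (hF : ContDiff ℝ 1 F)
    (l m : ℝ → ℝ → ℝ)
    (hl : l = fun x z => -x / (3 * z))
    (hm : m = fun x z => -1/2 + F (z / x ^ 3) / x ^ 2) :
    ∀ x z : ℝ, x ≠ 0 → z ≠ 0 →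
      dx (dx (dx l)) x z - 3 * l x z * dx l x z + dz l x z = 0 ∧
      dx l x z - dz m x z + 2 * dx l x z * m x z + l x z * dx m x z = 0 := by
  subst hl hm
  intro x z hx hz
  have hlx : dx (fun x z => -x / (3 * z)) = fun _ z => -1 / (3 * z) := by
    funext a b
    exact ((hasDerivAt_id a).neg.div_const (3 * b)).deriv
  have hlxx : dx (fun _ z : ℝ => -1 / (3 * z)) = fun _ _ => 0 := by
    funext a b
    simp [dx]
  have hlxxx : dx (fun _ _ : ℝ => 0) = fun _ _ => 0 := by
    funext a b
    simp [dx]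
  have hlz : dz (fun x z => -x / (3 * z)) x z = x / (3 * z ^ 2) := by
    have h := (hasDerivAt_const z (-x)).div ((hasDerivAt_id z).const_mul 3)
      (mul_ne_zero three_ne_zero hz)
    refine h.deriv.trans ?_
    simp only [id]
    field_simp
    ring
  have hF' : HasDerivAt F (deriv F (z / x ^ 3)) (z / x ^ 3) :=
    (hF.differentiable one_ne_zero _).hasDerivAt
  have hmz : dz (fun x z => -1/2 + F (z / x ^ 3) / x ^ 2) x z =
      deriv F (z / x ^ 3) / x ^ 5 := by
    have h := ((hF'.comp z ((hasDerivAt_id z).div_const (x ^ 3))).div_const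
      (x ^ 2)).const_add (-1/2)
    refine h.deriv.trans ?_
    field_simp
  have hmx : dx (fun x z => -1/2 + F (z / x ^ 3) / x ^ 2) x z =
      -3 * z * deriv F (z / x ^ 3) / x ^ 6 - 2 * F (z / x ^ 3) / x ^ 3 := by
    have h := ((hF'.comp x ((hasDerivAt_const x z).div (hasDerivAt_pow 3 x)
      (pow_ne_zero 3 hx))).div (hasDerivAt_pow 2 x) (pow_ne_zero 2 hx)).const_add (-1/2)
    refine h.deriv.trans ?_
    simp only [Function.comp, Pi.div_apply]
    generalize deriv F (z / x ^ 3) = d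
    generalize F (z / x ^ 3) = f
    field_simp
    norm_num
    ring
  rw [hlx, hlxx, hlxxx, hlz, hmz, hmx]
  beta_reduce
  generalize deriv F (z / x ^ 3) = d
  generalize F (z / x ^ 3) = f
  constructor <;> field_simp <;> ring
end

section
/- The two-soliton function l(x,z) = −24 · (4 cosh(2x − 8z) + cosh(4x − 64z) + 3) / (3 cosh(x − 28z) + cosh(3x − 36z))² satisfies the KdV equation l_z − 3 l l_x + l_{xxx} = 0 at every point of ℝ². -/
theorem HasDerivAt.div_pow_of_ne_zero {f g : ℝ → ℝ} {f' g' x : ℝ} (n : ℕ)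
    (hf : HasDerivAt f f' x) (hg : HasDerivAt g g' x) (hx : g x ≠ 0) :
    HasDerivAt (fun t => f t / g t ^ n) ((f' * g x - n * f x * g') / g x ^ (n + 1)) x := by
  refine (hf.div (hg.pow n) (pow_ne_zero n hx)).congr_deriv ?_
  rcases n with _ | n
  · simp [hx]
  · simp only [Pi.pow_apply, Nat.add_sub_cancel]
    field_simp
    ring

theorem two_cosh_mul_cosh_sub_sinh_mul_sinh_pos (a b : ℝ) :
    0 < 2 * Real.cosh b * Real.cosh a - Real.sinh b * Real.sinh a := by
  have h := Real.cosh_pos (b - a)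
  rw [Real.cosh_sub] at h
  nlinarith [mul_pos (Real.cosh_pos b) (Real.cosh_pos a)]

theorem two_soliton_eq (x z : ℝ) :
    -24 * (4 * Real.cosh (2 * x - 8 * z) + Real.cosh (4 * x - 64 * z) + 3) /
        (3 * Real.cosh (x - 28 * z) + Real.cosh (3 * x - 36 * z)) ^ 2 =
      -12 * (4 * Real.cosh (x - 4 * z) ^ 2 + Real.sinh (2 * x - 32 * z) ^ 2) /
        (2 * Real.cosh (2 * x - 32 * z) * Real.cosh (x - 4 * z) -
          Real.sinh (2 * x - 32 * z) * Real.sinh (x - 4 * z)) ^ 2 := by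
  have hD := two_cosh_mul_cosh_sub_sinh_mul_sinh_pos (x - 4 * z) (2 * x - 32 * z)
  rw [show 2 * x - 8 * z = 2 * (x - 4 * z) by ring,
    show 4 * x - 64 * z = 2 * (2 * x - 32 * z) by ring,
    show x - 28 * z = (2 * x - 32 * z) - (x - 4 * z) by ring,
    show 3 * x - 36 * z = (2 * x - 32 * z) + (x - 4 * z) by ring,
    Real.cosh_two_mul, Real.cosh_two_mul]
  generalize x - 4 * z = a at *
  generalize 2 * x - 32 * z = b at *
  rw [Real.cosh_sub, Real.cosh_add, show 3 * (Real.cosh b * Real.cosh a - Real.sinh b * Real.sinh a) +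
      (Real.cosh b * Real.cosh a + Real.sinh b * Real.sinh a) =
      2 * (2 * Real.cosh b * Real.cosh a - Real.sinh b * Real.sinh a) by ring,
    Real.sinh_sq a, Real.cosh_sq b]
  field_simp
  ring

/-- The two-soliton function
`l(x,z) = −24 (4 cosh(2x − 8z) + cosh(4x − 64z) + 3)/(3 cosh(x − 28z) + cosh(3x − 36z))²`
satisfies the KdV equation `l_z − 3 l l_x + l_{xxx} = 0` at every point of `ℝ²`. -/
theorem two_soliton_solves_kdv (l : ℝ → ℝ → ℝ)
    (hl : l = fun x z =>
      -24 * (4 * Real.cosh (2 * x - 8 * z) + Real.cosh (4 * x - 64 * z) + 3) /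
        (3 * Real.cosh (x - 28 * z) + Real.cosh (3 * x - 36 * z)) ^ 2) :
    ∀ x z : ℝ,
      dz l x z - 3 * l x z * dx l x z + dx (dx (dx l)) x z = 0 := by
  simp only [two_soliton_eq] at hl
  let c : ℝ → ℝ → ℝ := fun x z => Real.cosh (x - 4 * z)
  let s : ℝ → ℝ → ℝ := fun x z => Real.sinh (x - 4 * z)
  let C : ℝ → ℝ → ℝ := fun x z => Real.cosh (2 * x - 32 * z)
  let S : ℝ → ℝ → ℝ := fun x z => Real.sinh (2 * x - 32 * z)
  let D : ℝ → ℝ → ℝ := fun x z => 2 * C x z * c x z - S x z * s x z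
  let N : ℝ → ℝ → ℝ := fun x z => -12 * (4 * c x z ^ 2 + S x z ^ 2)
  let N₁ : ℝ → ℝ → ℝ := fun x z =>
    48 * s x z * C x z * S x z ^ 2 - 192 * c x z * S x z - 24 * c x z * S x z ^ 3 -
      192 * c x z ^ 2 * s x z * C x z + 384 * c x z ^ 3 * S x z
  let N₂ : ℝ → ℝ → ℝ := fun x z =>
    264 * S x z ^ 4 + 192 * c x z * s x z * C x z * S x z ^ 3 + 2304 * c x z ^ 2 * S x z ^ 2 -
      240 * c x z ^ 2 * S x z ^ 4 + 3072 * c x z ^ 3 * s x z * C x z * S x z +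
      384 * c x z ^ 4 - 3840 * c x z ^ 4 * S x z ^ 2
  have hD (x z : ℝ) : D x z ≠ 0 := (two_cosh_mul_cosh_sub_sinh_mul_sinh_pos _ _).ne'
  have hc (x z : ℝ) : c x z ^ 2 = s x z ^ 2 + 1 := Real.cosh_sq _
  have hC (x z : ℝ) : C x z ^ 2 = S x z ^ 2 + 1 := Real.cosh_sq _
  have ax (x z : ℝ) : HasDerivAt (fun t => t - 4 * z) 1 x := (hasDerivAt_id x).sub_const _
  have bx (x z : ℝ) : HasDerivAt (fun t => 2 * t - 32 * z) 2 x := by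
    simpa using ((hasDerivAt_id x).const_mul 2).sub_const (32 * z)
  have az (x z : ℝ) : HasDerivAt (fun t => x - 4 * t) (-4) z := by
    simpa using ((hasDerivAt_id z).const_mul 4).const_sub x
  have bz (x z : ℝ) : HasDerivAt (fun t => 2 * x - 32 * t) (-32) z := by
    simpa using ((hasDerivAt_id z).const_mul 32).const_sub (2 * x)
  have cx (x z : ℝ) : HasDerivAt (fun t => c t z) (s x z) x := by simpa using (ax x z).cosh
  have sx (x z : ℝ) : HasDerivAt (fun t => s t z) (c x z) x := by simpa using (ax x z).sinh
  have Cx (x z : ℝ) : HasDerivAt (fun t => C t z) (S x z * 2) x := (bx x z).cosh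
  have Sx (x z : ℝ) : HasDerivAt (fun t => S t z) (C x z * 2) x := (bx x z).sinh
  have cz (x z : ℝ) : HasDerivAt (fun t => c x t) (s x z * -4) z := (az x z).cosh
  have sz (x z : ℝ) : HasDerivAt (fun t => s x t) (c x z * -4) z := (az x z).sinh
  have Cz (x z : ℝ) : HasDerivAt (fun t => C x t) (S x z * -32) z := (bz x z).cosh
  have Sz (x z : ℝ) : HasDerivAt (fun t => S x t) (C x z * -32) z := (bz x z).sinh
  have Dx (x z : ℝ) : HasDerivAt (fun t => D t z) (3 * S x z * c x z) x :=
    ((((Cx x z).const_mul 2).mul (cx x z)).sub ((Sx x z).mul (sx x z))).congr_deriv (by ring)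
  have Dz (x z : ℝ) :
      HasDerivAt (fun t => D x t) (24 * C x z * s x z - 60 * S x z * c x z) z :=
    ((((Cz x z).const_mul 2).mul (cz x z)).sub ((Sz x z).mul (sz x z))).congr_deriv (by ring)
  have Nx (x z : ℝ) :
      HasDerivAt (fun t => N t z) (-12 * (8 * c x z * s x z + 4 * S x z * C x z)) x :=
    (((((cx x z).pow 2).const_mul 4).add ((Sx x z).pow 2)).const_mul (-12)).congr_deriv
      (by push_cast; ring)
  have Nz (x z : ℝ) :
      HasDerivAt (fun t => N x t) (12 * (32 * c x z * s x z + 64 * S x z * C x z)) z :=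
    (((((cz x z).pow 2).const_mul 4).add ((Sz x z).pow 2)).const_mul (-12)).congr_deriv
      (by push_cast; ring)
  have N₁x (x z : ℝ) : HasDerivAt (fun t => N₁ t z)
      (48 * c x z * C x z * S x z ^ 2 + 96 * s x z * S x z ^ 3 + 192 * s x z * C x z ^ 2 * S x z -
        192 * s x z * S x z - 384 * c x z * C x z - 24 * s x z * S x z ^ 3 -
        144 * c x z * S x z ^ 2 * C x z - 384 * c x z * s x z ^ 2 * C x z +
        768 * c x z ^ 2 * s x z * S x z + 576 * c x z ^ 3 * C x z) x :=
    (((((((sx x z).const_mul 48).mul (Cx x z)).mul ((Sx x z).pow 2)).sub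
      (((cx x z).const_mul 192).mul (Sx x z))).sub
      (((cx x z).const_mul 24).mul ((Sx x z).pow 3))).sub
      (((((cx x z).pow 2).const_mul 192).mul (sx x z)).mul (Cx x z))).add
      ((((cx x z).pow 3).const_mul 384).mul (Sx x z)) |>.congr_deriv
      (by simp only [Pi.mul_apply, Pi.pow_apply]; push_cast; ring)
  have N₂x (x z : ℝ) : HasDerivAt (fun t => N₂ t z)
      (2112 * C x z * S x z ^ 3 + 192 * s x z ^ 2 * C x z * S x z ^ 3 +
        4608 * c x z * s x z * S x z ^ 2 - 96 * c x z * s x z * S x z ^ 4 +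
        1152 * c x z * s x z * C x z ^ 2 * S x z ^ 2 + 9216 * c x z ^ 2 * C x z * S x z -
        1728 * c x z ^ 2 * C x z * S x z ^ 3 + 9216 * c x z ^ 2 * s x z ^ 2 * C x z * S x z +
        1536 * c x z ^ 3 * s x z - 9216 * c x z ^ 3 * s x z * S x z ^ 2 +
        6144 * c x z ^ 3 * s x z * C x z ^ 2 - 12288 * c x z ^ 4 * C x z * S x z) x :=
    (((((((((Sx x z).pow 4).const_mul 264).add
      (((((cx x z).const_mul 192).mul (sx x z)).mul (Cx x z)).mul ((Sx x z).pow 3))).add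
      ((((cx x z).pow 2).const_mul 2304).mul ((Sx x z).pow 2))).sub
      ((((cx x z).pow 2).const_mul 240).mul ((Sx x z).pow 4))).add
      ((((((cx x z).pow 3).const_mul 3072).mul (sx x z)).mul (Cx x z)).mul (Sx x z))).add
      (((cx x z).pow 4).const_mul 384)).sub
      ((((cx x z).pow 4).const_mul 3840).mul ((Sx x z).pow 2))) |>.congr_deriv
      (by simp only [Pi.mul_apply, Pi.pow_apply]; push_cast; ring)
  have hlx : dx l = fun x z => N₁ x z / D x z ^ 3 := by
    ext x z
    rw [hl]
    refine ((Nx x z).div_pow_of_ne_zero 2 (Dx x z) (hD x z)).deriv.trans ?_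
    congr 1
    have := hc x z
    have := hC x z
    simp only [N, N₁, D]
    push_cast
    grind
  have hlxx : dx (dx l) = fun x z => N₂ x z / D x z ^ 4 := by
    ext x z
    rw [hlx]
    refine ((N₁x x z).div_pow_of_ne_zero 3 (Dx x z) (hD x z)).deriv.trans ?_
    congr 1
    have := hc x z
    have := hC x z
    simp only [N₁, N₂, D]
    push_cast
    grind
  intro x z
  have hlxxx := ((N₂x x z).div_pow_of_ne_zero 4 (Dx x z) (hD x z)).deriv
  have hlz := ((Nz x z).div_pow_of_ne_zero 2 (Dz x z) (hD x z)).deriv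
  have hdz : dz l x z = deriv (fun t => N x t / D x t ^ 2) z := by rw [hl]; rfl
  have hl' : l x z = N x z / D x z ^ 2 := by rw [hl]
  rw [hdz, hlz, hl', hlxx, hlx]
  simp only [dx]
  rw [hlxxx]
  have hd := hD x z
  field_simp
  have := hc x z
  have := hC x z
  simp only [N, N₁, N₂, D]
  push_cast
  grind
end

section
/- Let λ ∈ ℝ and consider the open set of points (x,y,z) ∈ ℝ³ with x ≠ 0 and x² − 4λ + 4 > 0. On this set, the functions A(x,y,z) = 4 √(x²(x² − 4λ + 4)) / ((x² − 4λ + 4)(4 + x² + y² + z²)), B(x,y,z) = C(x,y,z) = (1 + (x² + y² + z²)/4)^{−1} satisfy the full Lamé system with curvature parameter λ; hence the metric ds² = A² dx² + (dy² + dz²)/(1 + (x² + y² + z²)/4)² has constant curvature λ. -/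
/-- Partial derivative in the first variable of a function of (x, y, z). -/
noncomputable def px (f : ℝ → ℝ → ℝ → ℝ) : ℝ → ℝ → ℝ → ℝ :=
  fun x y z => deriv (fun t => f t y z) x

/-- Partial derivative in the second variable of a function of (x, y, z). -/
noncomputable def py (f : ℝ → ℝ → ℝ → ℝ) : ℝ → ℝ → ℝ → ℝ :=
  fun x y z => deriv (fun t => f x t z) y

/-- Partial derivative in the third variable of a function of (x, y, z). -/
noncomputable def pz (f : ℝ → ℝ → ℝ → ℝ) : ℝ → ℝ → ℝ → ℝ :=
  fun x y z => deriv (fun t => f x y t) z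

/-- The Darboux system for the Lamé coefficients `A, B, C` of a diagonal metric,
at the point `(x, y, z)`. -/
def DarbouxSystem (A B C : ℝ → ℝ → ℝ → ℝ) (x y z : ℝ) : Prop :=
  py (pz A) x y z = (pz B x y z / B x y z) * py A x y z
      + (py C x y z / C x y z) * pz A x y z ∧
  px (pz B) x y z = (pz A x y z / A x y z) * px B x y z
      + (px C x y z / C x y z) * pz B x y z ∧
  px (py C) x y z = (py A x y z / A x y z) * px C x y z
      + (px B x y z / B x y z) * py C x y z

/-- The full Lamé system with curvature parameter `lam`: the Darboux system together with
the three second-order equations expressing that the diagonal metric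
`ds² = A² dx² + B² dy² + C² dz²` has constant curvature `lam`, at the point `(x, y, z)`. -/
def FullLameSystem (lam : ℝ) (A B C : ℝ → ℝ → ℝ → ℝ) (x y z : ℝ) : Prop :=
  DarbouxSystem A B C x y z ∧
  lam * C x y z * B x y z + (px C x y z * px B x y z) / (A x y z) ^ 2
      + pz (pz B) x y z / C x y z - (pz B x y z * pz C x y z) / (C x y z) ^ 2
      + py (py C) x y z / B x y z - (py B x y z * py C x y z) / (B x y z) ^ 2 = 0 ∧
  lam * A x y z * C x y z - (pz A x y z * pz C x y z) / (C x y z) ^ 2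
      + pz (pz A) x y z / C x y z + (py A x y z * py C x y z) / (B x y z) ^ 2
      + px (px C) x y z / A x y z - (px A x y z * px C x y z) / (A x y z) ^ 2 = 0 ∧
  lam * B x y z * A x y z - (px A x y z * px B x y z) / (A x y z) ^ 2
      + px (px B) x y z / A x y z + (pz A x y z * pz B x y z) / (C x y z) ^ 2
      + py (py A) x y z / B x y z - (py A x y z * py B x y z) / (B x y z) ^ 2 = 0

/-- If `g` restricted to a line is `c + t ^ 2` with `0 < c`, the quotient `k / g` has derivative
`-2 k t / g ^ 2`. -/
theorem hasDerivAt_const_div_add_sq {c : ℝ} (hc : 0 < c) (k t : ℝ) :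
    HasDerivAt (fun u => k / (c + u ^ 2)) (-(2 * k * t) / (c + t ^ 2) ^ 2) t := by
  have hg : c + t ^ 2 ≠ 0 := by positivity
  refine ((hasDerivAt_const t k).div ((hasDerivAt_pow 2 t).const_add c) hg).congr_deriv ?_
  simp
  ring

theorem hasDerivAt_const_div_add_sq_sq {c : ℝ} (hc : 0 < c) (k t : ℝ) :
    HasDerivAt (fun u => k / (c + u ^ 2) ^ 2) (-(4 * k * t) / (c + t ^ 2) ^ 3) t := by
  have hg : c + t ^ 2 ≠ 0 := by positivity
  refine ((hasDerivAt_const t k).div (((hasDerivAt_pow 2 t).const_add c).pow 2)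
    (pow_ne_zero 2 hg)).congr_deriv ?_
  simp
  field_simp
  ring

theorem hasDerivAt_mul_div_add_sq_sq {c : ℝ} (hc : 0 < c) (k t : ℝ) :
    HasDerivAt (fun u => k * u / (c + u ^ 2) ^ 2)
      (k / (c + t ^ 2) ^ 2 - 4 * k * t ^ 2 / (c + t ^ 2) ^ 3) t := by
  have hg : c + t ^ 2 ≠ 0 := by positivity
  refine (((hasDerivAt_id t).const_mul k).div (((hasDerivAt_pow 2 t).const_add c).pow 2)
    (pow_ne_zero 2 hg)).congr_deriv ?_
  simp
  field_simp
  ring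

section ConformalFactor

variable (F : ℝ → ℝ) (x y z : ℝ)

theorem py_div_conformal :
    py (fun x y z => F x / (4 + x ^ 2 + y ^ 2 + z ^ 2)) =
      fun x y z => (-2 * F x) * y / (4 + x ^ 2 + y ^ 2 + z ^ 2) ^ 2 := by
  funext x y z
  convert (hasDerivAt_const_div_add_sq (c := 4 + x ^ 2 + z ^ 2) (by positivity) (F x) y).deriv
    using 1
  · simp only [py]
    congr 1
    funext t
    ring
  · ring

theorem pz_div_conformal :
    pz (fun x y z => F x / (4 + x ^ 2 + y ^ 2 + z ^ 2)) =
      fun x y z => (-2 * F x) * z / (4 + x ^ 2 + y ^ 2 + z ^ 2) ^ 2 := by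
  funext x y z
  convert (hasDerivAt_const_div_add_sq (c := 4 + x ^ 2 + y ^ 2) (by positivity) (F x) z).deriv
    using 1
  · rfl
  · ring

theorem py_py_div_conformal :
    py (py (fun x y z => F x / (4 + x ^ 2 + y ^ 2 + z ^ 2))) x y z =
      -2 * F x / (4 + x ^ 2 + y ^ 2 + z ^ 2) ^ 2
        + 8 * F x * y ^ 2 / (4 + x ^ 2 + y ^ 2 + z ^ 2) ^ 3 := by
  rw [py_div_conformal]
  convert (hasDerivAt_mul_div_add_sq_sq (c := 4 + x ^ 2 + z ^ 2) (by positivity)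
    (-2 * F x) y).deriv using 1
  · simp only [py]
    congr 1
    funext t
    ring
  · ring

theorem pz_pz_div_conformal :
    pz (pz (fun x y z => F x / (4 + x ^ 2 + y ^ 2 + z ^ 2))) x y z =
      -2 * F x / (4 + x ^ 2 + y ^ 2 + z ^ 2) ^ 2
        + 8 * F x * z ^ 2 / (4 + x ^ 2 + y ^ 2 + z ^ 2) ^ 3 := by
  rw [pz_div_conformal]
  convert (hasDerivAt_mul_div_add_sq_sq (c := 4 + x ^ 2 + y ^ 2) (by positivity)
    (-2 * F x) z).deriv using 1
  · rfl
  · ring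

theorem py_pz_div_conformal :
    py (pz (fun x y z => F x / (4 + x ^ 2 + y ^ 2 + z ^ 2))) x y z =
      8 * F x * y * z / (4 + x ^ 2 + y ^ 2 + z ^ 2) ^ 3 := by
  rw [pz_div_conformal]
  convert (hasDerivAt_const_div_add_sq_sq (c := 4 + x ^ 2 + z ^ 2) (by positivity)
    (-2 * F x * z) y).deriv using 1
  · simp only [py]
    congr 1
    funext t
    ring
  · ring

variable {F x} in
theorem px_div_conformal {F' : ℝ} (hF : HasDerivAt F F' x) :
    px (fun x y z => F x / (4 + x ^ 2 + y ^ 2 + z ^ 2)) x y z =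
      F' / (4 + x ^ 2 + y ^ 2 + z ^ 2)
        - 2 * F x * x / (4 + x ^ 2 + y ^ 2 + z ^ 2) ^ 2 := by
  have hg : 4 + x ^ 2 + y ^ 2 + z ^ 2 ≠ 0 := by positivity
  have hd : HasDerivAt (fun t : ℝ => 4 + t ^ 2 + y ^ 2 + z ^ 2) (2 * x) x := by
    simpa using (((hasDerivAt_pow 2 x).const_add 4).add_const (y ^ 2)).add_const (z ^ 2)
  refine (hF.div hd hg).deriv.trans ?_
  field_simp

variable (k : ℝ)

theorem px_const_div_conformal :
    px (fun x y z => k / (4 + x ^ 2 + y ^ 2 + z ^ 2)) =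
      fun x y z => (-2 * k) * x / (4 + x ^ 2 + y ^ 2 + z ^ 2) ^ 2 := by
  funext x y z
  rw [px_div_conformal (F := fun _ => k) y z (hasDerivAt_const x k)]
  ring

theorem px_px_const_div_conformal :
    px (px (fun x y z => k / (4 + x ^ 2 + y ^ 2 + z ^ 2))) x y z =
      -2 * k / (4 + x ^ 2 + y ^ 2 + z ^ 2) ^ 2
        + 8 * k * x ^ 2 / (4 + x ^ 2 + y ^ 2 + z ^ 2) ^ 3 := by
  rw [px_const_div_conformal]
  convert (hasDerivAt_mul_div_add_sq_sq (c := 4 + y ^ 2 + z ^ 2) (by positivity)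
    (-2 * k) x).deriv using 1
  · simp only [px]
    congr 1
    funext t
    ring
  · ring

theorem px_py_const_div_conformal :
    px (py (fun x y z => k / (4 + x ^ 2 + y ^ 2 + z ^ 2))) x y z =
      8 * k * x * y / (4 + x ^ 2 + y ^ 2 + z ^ 2) ^ 3 := by
  rw [py_div_conformal (fun _ => k)]
  convert (hasDerivAt_const_div_add_sq_sq (c := 4 + y ^ 2 + z ^ 2) (by positivity)
    (-2 * k * y) x).deriv using 1
  · simp only [px]
    congr 1
    funext t
    ring
  · ring

theorem px_pz_const_div_conformal :
    px (pz (fun x y z => k / (4 + x ^ 2 + y ^ 2 + z ^ 2))) x y z =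
      8 * k * x * z / (4 + x ^ 2 + y ^ 2 + z ^ 2) ^ 3 := by
  rw [pz_div_conformal (fun _ => k)]
  convert (hasDerivAt_const_div_add_sq_sq (c := 4 + y ^ 2 + z ^ 2) (by positivity)
    (-2 * k * z) x).deriv using 1
  · simp only [px]
    congr 1
    funext t
    ring
  · ring

end ConformalFactor

theorem hasDerivAt_radial_coefficient {lam x : ℝ} (hx : x ≠ 0)
    (hE : 0 < x ^ 2 - 4 * lam + 4) :
    HasDerivAt (fun t => 4 * Real.sqrt (t ^ 2 * (t ^ 2 - 4 * lam + 4)) / (t ^ 2 - 4 * lam + 4))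
      (4 * Real.sqrt (x ^ 2 * (x ^ 2 - 4 * lam + 4)) / (x ^ 2 - 4 * lam + 4)
        * (4 - 4 * lam) / (x * (x ^ 2 - 4 * lam + 4))) x := by
  have hd : HasDerivAt (fun t : ℝ => t ^ 2 - 4 * lam + 4) (2 * x) x := by
    simpa using ((hasDerivAt_pow 2 x).sub_const (4 * lam)).add_const 4
  have hp : 0 < x ^ 2 * (x ^ 2 - 4 * lam + 4) := by positivity
  have hs := (((hasDerivAt_pow 2 x).mul hd).sqrt hp.ne').const_mul 4
  refine (hs.div hd hE.ne').congr_deriv ?_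
  simp only [Pi.mul_apply]
  have hq := Real.sq_sqrt hp.le
  have hr := Real.sqrt_pos.2 hp
  generalize Real.sqrt (x ^ 2 * (x ^ 2 - 4 * lam + 4)) = s at *
  generalize hEe : x ^ 2 - 4 * lam + 4 = E at *
  obtain rfl : lam = (x ^ 2 + 4 - E) / 4 := by linarith
  field_simp
  rw [hq]
  push_cast
  ring

theorem fullLameSystem_of_hasDerivAt {lam x F' : ℝ} {F : ℝ → ℝ} (y z : ℝ) (hx : x ≠ 0)
    (hF : HasDerivAt F F' x)
    (hsq : F x ^ 2 * (x ^ 2 - 4 * lam + 4) = 16 * x ^ 2)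
    (hF' : F' = F x * (4 - 4 * lam) / (x * (x ^ 2 - 4 * lam + 4))) :
    FullLameSystem lam (fun x y z => F x / (4 + x ^ 2 + y ^ 2 + z ^ 2))
      (fun x y z => 4 / (4 + x ^ 2 + y ^ 2 + z ^ 2))
      (fun x y z => 4 / (4 + x ^ 2 + y ^ 2 + z ^ 2)) x y z := by
  have hF0 : F x ≠ 0 := by
    intro h
    rw [h] at hsq
    apply hx
    nlinarith
  have hyF := py_div_conformal F
  have hzF := pz_div_conformal F
  have hy4 := py_div_conformal (fun _ => 4)
  have hz4 := pz_div_conformal (fun _ => 4)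
  have hyy4 := py_py_div_conformal (fun _ => 4) x y z
  have hzz4 := pz_pz_div_conformal (fun _ => 4) x y z
  simp only [FullLameSystem, DarbouxSystem, py_pz_div_conformal F, px_py_const_div_conformal,
    px_pz_const_div_conformal, px_px_const_div_conformal, py_py_div_conformal F,
    pz_pz_div_conformal F, hyy4, hzz4]
  simp only [px_div_conformal y z hF, px_const_div_conformal, hyF, hzF, hy4, hz4]
  have hg : 4 + x ^ 2 + y ^ 2 + z ^ 2 ≠ 0 := by positivity
  have hlam : lam = (x ^ 2 + 4 - 16 * x ^ 2 / F x ^ 2) / 4 := by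
    field_simp
    linarith
  have hEF : x ^ 2 - 4 * lam + 4 = 16 * x ^ 2 / F x ^ 2 := by
    field_simp
    linarith
  rw [hEF] at hF'
  subst hF'
  clear hF hsq hEF hyF hzF hy4 hz4 hyy4 hzz4
  subst hlam
  generalize F x = f at *
  refine ⟨⟨?_, ?_, ?_⟩, ?_, ?_, ?_⟩ <;> field_simp <;> ring

/-- For `λ ∈ ℝ`, on the open set of points with `x ≠ 0` and `x² − 4λ + 4 > 0`, the
functions `A = 4√(x²(x² − 4λ + 4)) / ((x² − 4λ + 4)(4 + x² + y² + z²))` and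
`B = C = (1 + (x² + y² + z²)/4)^{−1}` satisfy the full Lamé system with curvature
parameter `λ`: the metric `ds² = A² dx² + (dy² + dz²)/(1 + (x² + y² + z²)/4)²` has
constant curvature `λ`. -/
theorem deformed_metric_constant_curvature (lam : ℝ) (A B C : ℝ → ℝ → ℝ → ℝ)
    (hA : A = fun x y z =>
      4 * Real.sqrt (x ^ 2 * (x ^ 2 - 4 * lam + 4)) /
        ((x ^ 2 - 4 * lam + 4) * (4 + x ^ 2 + y ^ 2 + z ^ 2)))
    (hB : B = fun x y z => (1 + (x ^ 2 + y ^ 2 + z ^ 2) / 4)⁻¹)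
    (hC : C = B) :
    ∀ x y z : ℝ, x ≠ 0 → 0 < x ^ 2 - 4 * lam + 4 →
      FullLameSystem lam A B C x y z := by
  intro x y z hx hE
  have hB4 : B = fun x y z => 4 / (4 + x ^ 2 + y ^ 2 + z ^ 2) := by
    rw [hB]
    funext x y z
    have hg : 4 + x ^ 2 + y ^ 2 + z ^ 2 ≠ 0 := by positivity
    rw [inv_eq_iff_eq_inv, inv_div]
    ring
  simp only [← div_div] at hA
  rw [hC, hA, hB4]
  refine fullLameSystem_of_hasDerivAt y z hx (hasDerivAt_radial_coefficient hx hE) ?_ rfl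
  have hp : 0 ≤ x ^ 2 * (x ^ 2 - 4 * lam + 4) := by positivity
  rw [div_pow, mul_pow, Real.sq_sqrt hp]
  field_simp
  norm_num
end

section
/- Let A, B, C, K₁, K₂, K₃ : Ω → ℝ be smooth functions on an open set Ω ⊆ ℝ³ with A, B, C nonvanishing and A_y, A_z nonvanishing on Ω. Suppose the relations hold on Ω: K₁_y = (A_y/A)(K₂ − K₁); K₁_z = −(A_z/A)(K₁ − K₃); K₂_x = −(B_x/B)(K₂ − K₁); K₂_z = −(B_z/B)(K₂ − K₃); K₃_x = (C_x/C)(K₁ − K₃); K₃_y = (C_y/C)(K₂ − K₃). Then K₁ satisfies the three second-order equations on Ω: (i) K₁_{xy} + (A_y/A) K₁_x + (A_x/A + B_x/B − A_{xy}/A_y) K₁_y = 0; (ii) K₁_{xz} + (A_z/A) K₁_x + (C_x/C + A_x/A − A_{xz}/A_z) K₁_z = 0; (iii) K₁_{yz} + (B_z/B + A_z/A − A_{yz}/A_y) K₁_y + (−(A_y B_z)/(A_z B) + A_y/A) K₁_z = 0. -/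
/-- The function of a point of `ℝ × ℝ × ℝ` underlying a function of three real variables. -/
def uncurryTriple (f : ℝ → ℝ → ℝ → ℝ) : ℝ × ℝ × ℝ → ℝ := fun p => f p.1 p.2.1 p.2.2

section PartialDerivatives

variable {Ω : Set (ℝ × ℝ × ℝ)} {f : ℝ → ℝ → ℝ → ℝ} {x y z : ℝ}

theorem hasDerivAt_slice_fst (hf : DifferentiableAt ℝ (uncurryTriple f) (x, y, z)) :
    HasDerivAt (fun t => f t y z) (fderiv ℝ (uncurryTriple f) (x, y, z) (1, 0, 0)) x :=
  hf.hasFDerivAt.comp_hasDerivAt (f := fun t : ℝ => (t, y, z)) x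
    ((hasDerivAt_id x).prodMk ((hasDerivAt_const x y).prodMk (hasDerivAt_const x z)))

theorem hasDerivAt_slice_snd (hf : DifferentiableAt ℝ (uncurryTriple f) (x, y, z)) :
    HasDerivAt (fun t => f x t z) (fderiv ℝ (uncurryTriple f) (x, y, z) (0, 1, 0)) y :=
  hf.hasFDerivAt.comp_hasDerivAt (f := fun t : ℝ => (x, t, z)) y
    ((hasDerivAt_const y x).prodMk ((hasDerivAt_id y).prodMk (hasDerivAt_const y z)))

theorem hasDerivAt_slice_thd (hf : DifferentiableAt ℝ (uncurryTriple f) (x, y, z)) :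
    HasDerivAt (fun t => f x y t) (fderiv ℝ (uncurryTriple f) (x, y, z) (0, 0, 1)) z :=
  hf.hasFDerivAt.comp_hasDerivAt (f := fun t : ℝ => (x, y, t)) z
    ((hasDerivAt_const z x).prodMk ((hasDerivAt_const z y).prodMk (hasDerivAt_id z)))

theorem hasDerivAt_px (hf : DifferentiableAt ℝ (uncurryTriple f) (x, y, z)) :
    HasDerivAt (fun t => f t y z) (px f x y z) x :=
  (hasDerivAt_slice_fst hf).differentiableAt.hasDerivAt

theorem hasDerivAt_pz (hf : DifferentiableAt ℝ (uncurryTriple f) (x, y, z)) :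
    HasDerivAt (fun t => f x y t) (pz f x y z) z :=
  (hasDerivAt_slice_thd hf).differentiableAt.hasDerivAt

theorem py_eq_fderiv (hf : DifferentiableAt ℝ (uncurryTriple f) (x, y, z)) :
    py f x y z = fderiv ℝ (uncurryTriple f) (x, y, z) (0, 1, 0) :=
  (hasDerivAt_slice_snd hf).deriv

theorem pz_eq_fderiv (hf : DifferentiableAt ℝ (uncurryTriple f) (x, y, z)) :
    pz f x y z = fderiv ℝ (uncurryTriple f) (x, y, z) (0, 0, 1) :=
  (hasDerivAt_slice_thd hf).deriv

theorem eventually_differentiableAt_uncurryTriple {p : ℝ × ℝ × ℝ}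
    (hf : ContDiffAt ℝ 2 (uncurryTriple f) p) :
    ∀ᶠ q in nhds p, DifferentiableAt ℝ (uncurryTriple f) q :=
  (hf.eventually (by simp)).mono fun _ hq => hq.differentiableAt (by simp)

theorem uncurryTriple_py_eventuallyEq {p : ℝ × ℝ × ℝ}
    (hf : ContDiffAt ℝ 2 (uncurryTriple f) p) :
    uncurryTriple (py f) =ᶠ[nhds p] fun q => fderiv ℝ (uncurryTriple f) q (0, 1, 0) :=
  (eventually_differentiableAt_uncurryTriple hf).mono fun _ hq => py_eq_fderiv hq

theorem uncurryTriple_pz_eventuallyEq {p : ℝ × ℝ × ℝ}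
    (hf : ContDiffAt ℝ 2 (uncurryTriple f) p) :
    uncurryTriple (pz f) =ᶠ[nhds p] fun q => fderiv ℝ (uncurryTriple f) q (0, 0, 1) :=
  (eventually_differentiableAt_uncurryTriple hf).mono fun _ hq => pz_eq_fderiv hq

theorem differentiableAt_fderiv_of_contDiffAt_two {p : ℝ × ℝ × ℝ}
    (hf : ContDiffAt ℝ 2 (uncurryTriple f) p) :
    DifferentiableAt ℝ (fderiv ℝ (uncurryTriple f)) p :=
  (hf.fderiv_right (m := 1) (by norm_num)).differentiableAt (by simp)

theorem differentiableAt_uncurryTriple_py {p : ℝ × ℝ × ℝ}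
    (hf : ContDiffAt ℝ 2 (uncurryTriple f) p) :
    DifferentiableAt ℝ (uncurryTriple (py f)) p :=
  ((differentiableAt_fderiv_of_contDiffAt_two hf).clm_apply
    (differentiableAt_const _)).congr_of_eventuallyEq (uncurryTriple_py_eventuallyEq hf)

theorem differentiableAt_uncurryTriple_pz {p : ℝ × ℝ × ℝ}
    (hf : ContDiffAt ℝ 2 (uncurryTriple f) p) :
    DifferentiableAt ℝ (uncurryTriple (pz f)) p :=
  ((differentiableAt_fderiv_of_contDiffAt_two hf).clm_apply
    (differentiableAt_const _)).congr_of_eventuallyEq (uncurryTriple_pz_eventuallyEq hf)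

/-- Symmetry of the mixed partial derivatives in the last two variables. -/
theorem py_pz_comm (hf : ContDiffAt ℝ 2 (uncurryTriple f) (x, y, z)) :
    py (pz f) x y z = pz (py f) x y z := by
  have hd := differentiableAt_fderiv_of_contDiffAt_two hf
  rw [py_eq_fderiv (differentiableAt_uncurryTriple_pz hf),
    pz_eq_fderiv (differentiableAt_uncurryTriple_py hf),
    (uncurryTriple_pz_eventuallyEq hf).fderiv_eq, (uncurryTriple_py_eventuallyEq hf).fderiv_eq,
    fderiv_clm_apply hd (differentiableAt_const _), fderiv_clm_apply hd (differentiableAt_const _)]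
  simpa using (hf.isSymmSndFDerivAt (by simp)).eq (0, 1, 0) (0, 0, 1)

theorem px_eq_of_eqOn {g : ℝ → ℝ → ℝ → ℝ} {d : ℝ} (hΩ : IsOpen Ω) (hp : (x, y, z) ∈ Ω)
    (hfg : ∀ x y z, (x, y, z) ∈ Ω → f x y z = g x y z)
    (hg : HasDerivAt (fun t => g t y z) d x) : px f x y z = d := by
  have hc : ContinuousAt (fun t : ℝ => (t, y, z)) x := by fun_prop
  exact (hg.congr_of_eventuallyEq
    (Filter.Eventually.mono (hc.preimage_mem_nhds (hΩ.mem_nhds hp)) fun t ht => hfg t y z ht)).deriv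

theorem pz_eq_of_eqOn {g : ℝ → ℝ → ℝ → ℝ} {d : ℝ} (hΩ : IsOpen Ω) (hp : (x, y, z) ∈ Ω)
    (hfg : ∀ x y z, (x, y, z) ∈ Ω → f x y z = g x y z)
    (hg : HasDerivAt (fun t => g x y t) d z) : pz f x y z = d := by
  have hc : ContinuousAt (fun t : ℝ => (x, y, t)) z := by fun_prop
  exact (hg.congr_of_eventuallyEq
    (Filter.Eventually.mono (hc.preimage_mem_nhds (hΩ.mem_nhds hp)) fun t ht => hfg x y t ht)).deriv

end PartialDerivatives

/-- Principal curvatures of a normal Riemann space: if `A, B, C, K₁, K₂, K₃` are smooth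
on an open `Ω ⊆ ℝ³`, `A, B, C, A_y, A_z` nonvanishing on `Ω`, and the first-order
relations among the `Kᵢ` hold, then `K₁` satisfies the three second-order linear
equations on `Ω`. -/
theorem normal_space_K1_system (Ω : Set (ℝ × ℝ × ℝ)) (hΩ : IsOpen Ω)
    (A B C K₁ K₂ K₃ : ℝ → ℝ → ℝ → ℝ)
    (hA : ContDiffOn ℝ (⊤ : ℕ∞) (fun p : ℝ × ℝ × ℝ => A p.1 p.2.1 p.2.2) Ω)
    (hB : ContDiffOn ℝ (⊤ : ℕ∞) (fun p : ℝ × ℝ × ℝ => B p.1 p.2.1 p.2.2) Ω)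
    (hC : ContDiffOn ℝ (⊤ : ℕ∞) (fun p : ℝ × ℝ × ℝ => C p.1 p.2.1 p.2.2) Ω)
    (hK₁ : ContDiffOn ℝ (⊤ : ℕ∞) (fun p : ℝ × ℝ × ℝ => K₁ p.1 p.2.1 p.2.2) Ω)
    (hK₂ : ContDiffOn ℝ (⊤ : ℕ∞) (fun p : ℝ × ℝ × ℝ => K₂ p.1 p.2.1 p.2.2) Ω)
    (hK₃ : ContDiffOn ℝ (⊤ : ℕ∞) (fun p : ℝ × ℝ × ℝ => K₃ p.1 p.2.1 p.2.2) Ω)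
    (hA0 : ∀ x y z, (x, y, z) ∈ Ω → A x y z ≠ 0)
    (hB0 : ∀ x y z, (x, y, z) ∈ Ω → B x y z ≠ 0)
    (hC0 : ∀ x y z, (x, y, z) ∈ Ω → C x y z ≠ 0)
    (hAy0 : ∀ x y z, (x, y, z) ∈ Ω → py A x y z ≠ 0)
    (hAz0 : ∀ x y z, (x, y, z) ∈ Ω → pz A x y z ≠ 0)
    (h1 : ∀ x y z, (x, y, z) ∈ Ω →
      py K₁ x y z = (py A x y z / A x y z) * (K₂ x y z - K₁ x y z))
    (h2 : ∀ x y z, (x, y, z) ∈ Ω →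
      pz K₁ x y z = -(pz A x y z / A x y z) * (K₁ x y z - K₃ x y z))
    (h3 : ∀ x y z, (x, y, z) ∈ Ω →
      px K₂ x y z = -(px B x y z / B x y z) * (K₂ x y z - K₁ x y z))
    (h4 : ∀ x y z, (x, y, z) ∈ Ω →
      pz K₂ x y z = -(pz B x y z / B x y z) * (K₂ x y z - K₃ x y z))
    (h5 : ∀ x y z, (x, y, z) ∈ Ω →
      px K₃ x y z = (px C x y z / C x y z) * (K₁ x y z - K₃ x y z))
    (h6 : ∀ x y z, (x, y, z) ∈ Ω →
      py K₃ x y z = (py C x y z / C x y z) * (K₂ x y z - K₃ x y z)) :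
    ∀ x y z, (x, y, z) ∈ Ω →
      (px (py K₁) x y z + (py A x y z / A x y z) * px K₁ x y z
        + (px A x y z / A x y z + px B x y z / B x y z
            - px (py A) x y z / py A x y z) * py K₁ x y z = 0) ∧
      (px (pz K₁) x y z + (pz A x y z / A x y z) * px K₁ x y z
        + (px C x y z / C x y z + px A x y z / A x y z
            - px (pz A) x y z / pz A x y z) * pz K₁ x y z = 0) ∧
      (py (pz K₁) x y z
        + (pz B x y z / B x y z + pz A x y z / A x y z
            - py (pz A) x y z / py A x y z) * py K₁ x y z
        + (-(py A x y z * pz B x y z) / (pz A x y z * B x y z)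
            + py A x y z / A x y z) * pz K₁ x y z = 0) := by
  intro x y z hp
  have smooth : ∀ {f : ℝ → ℝ → ℝ → ℝ},
      ContDiffOn ℝ (⊤ : ℕ∞) (fun p : ℝ × ℝ × ℝ => f p.1 p.2.1 p.2.2) Ω →
      ContDiffAt ℝ 2 (uncurryTriple f) (x, y, z) := fun hf =>
    (hf.contDiffAt (hΩ.mem_nhds hp)).of_le (WithTop.coe_le_coe.2 le_top : ((2 : ℕ∞) : WithTop ℕ∞) ≤ _)
  have hA2 := smooth hA
  have hK₁2 := smooth hK₁
  have dA := hA2.differentiableAt (by simp)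
  have dK₁ := hK₁2.differentiableAt (by simp)
  have dK₂ := (smooth hK₂).differentiableAt (by simp)
  have dK₃ := (smooth hK₃).differentiableAt (by simp)
  have dAy := differentiableAt_uncurryTriple_py hA2
  have dAz := differentiableAt_uncurryTriple_pz hA2
  have a0 := hA0 x y z hp
  have b0 := hB0 x y z hp
  have c0 := hC0 x y z hp
  have ay0 := hAy0 x y z hp
  have az0 := hAz0 x y z hp
  refine ⟨?_, ?_, ?_⟩
  · rw [px_eq_of_eqOn (g := fun x y z => (py A x y z / A x y z) * (K₂ x y z - K₁ x y z)) hΩ hp h1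
      (((hasDerivAt_px dAy).div (hasDerivAt_px dA) a0).mul
        ((hasDerivAt_px dK₂).sub (hasDerivAt_px dK₁))), h1 x y z hp, h3 x y z hp]
    simp only [Pi.div_apply]
    field_simp
    ring
  · rw [px_eq_of_eqOn (g := fun x y z => -(pz A x y z / A x y z) * (K₁ x y z - K₃ x y z)) hΩ hp h2
      (((hasDerivAt_px dAz).div (hasDerivAt_px dA) a0).neg.mul
        ((hasDerivAt_px dK₁).sub (hasDerivAt_px dK₃))), h2 x y z hp, h5 x y z hp]
    simp only [Pi.div_apply, Pi.neg_apply]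
    field_simp
    ring
  · rw [py_pz_comm hK₁2, py_pz_comm hA2,
      pz_eq_of_eqOn (g := fun x y z => (py A x y z / A x y z) * (K₂ x y z - K₁ x y z)) hΩ hp h1
      (((hasDerivAt_pz dAy).div (hasDerivAt_pz dA) a0).mul
        ((hasDerivAt_pz dK₂).sub (hasDerivAt_pz dK₁))), h1 x y z hp, h2 x y z hp, h4 x y z hp]
    simp only [Pi.div_apply]
    field_simp
    ring
end

section
/- Let a, b, c, U, V, W : ℝ → ℝ be smooth functions of one variable and let Ω ⊆ ℝ³ be an open set on which a(x) > b(y) > c(z). Define on Ω: A(x,y,z) = U(x)/(√(a(x)−b(y)) √(a(x)−c(z))), B(x,y,z) = V(y)/((a(x)−b(y))^{5/2} √(b(y)−c(z))), C(x,y,z) = W(z)/((a(x)−c(z))^{5/2} √(b(y)−c(z))). If U, V, W are nonvanishing, then A, B, C satisfy the Darboux system on Ω: A_{yz} = (B_z/B) A_y + (C_y/C) A_z, B_{xz} = (A_z/A) B_x + (C_x/C) B_z, C_{xy} = (A_y/A) C_x + (B_x/B) C_y. -/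
/-- Logarithmic form of the derivative of a quotient whose denominator has one varying factor. -/
theorem HasDerivAt.const_div_mul_const {h : ℝ → ℝ} {l t : ℝ} (hh : HasDerivAt h (h t * l) t)
    (h0 : h t ≠ 0) (k m : ℝ) :
    HasDerivAt (fun s => k / (h s * m)) (k / (h t * m) * -l) t := by
  have h1 := (hh.inv h0).const_mul (k / m)
  have hfun : (fun s => k / (h s * m)) = fun s => k / m * (h⁻¹) s := by
    funext s
    simp only [Pi.inv_apply, div_eq_mul_inv, mul_inv]
    ring
  rw [hfun]
  refine h1.congr_deriv ?_
  by_cases hm : m = 0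
  · simp [hm]
  · field_simp

/-- Logarithmic form of the derivative of the square root of a positive function. -/
theorem HasDerivAt.sqrt_log {f : ℝ → ℝ} {f' t : ℝ} (hf : HasDerivAt f f' t) (h0 : 0 < f t) :
    HasDerivAt (fun s => Real.sqrt (f s)) (Real.sqrt (f t) * (f' / (2 * f t))) t := by
  refine (hf.sqrt h0.ne').congr_deriv ?_
  have h1 := Real.sqrt_pos.2 h0
  have h2 := Real.sq_sqrt h0.le
  field_simp
  rw [h2]

/-- Logarithmic form of the derivative of a real power of a positive function. -/
theorem HasDerivAt.rpow_log {f : ℝ → ℝ} {f' t : ℝ} (hf : HasDerivAt f f' t) (h0 : 0 < f t)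
    (p : ℝ) : HasDerivAt (fun s => f s ^ p) (f t ^ p * (p * f' / f t)) t := by
  refine (hf.rpow_const (p := p) (Or.inl h0.ne')).congr_deriv ?_
  rw [Real.rpow_sub_one h0.ne']
  ring

/-- Components of the metric of a Darboux space determined by principal curvatures
satisfying `K₁(b−c) + K₂(c−a) + K₃(a−b) = 0`: for smooth one-variable functions
`a, b, c, U, V, W` with `U, V, W` nonvanishing and `a(x) > b(y) > c(z)` on an open
`Ω ⊆ ℝ³`, the functions
`A = U(x)/(√(a−b) √(a−c))`, `B = V(y)/((a−b)^{5/2} √(b−c))`,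
`C = W(z)/((a−c)^{5/2} √(b−c))` satisfy the Darboux system on `Ω`. -/
theorem darboux_space_metric_components (Ω : Set (ℝ × ℝ × ℝ)) (hΩ : IsOpen Ω)
    (a b c U V W : ℝ → ℝ)
    (ha : ContDiff ℝ (⊤ : ℕ∞) a) (hb : ContDiff ℝ (⊤ : ℕ∞) b)
    (hc : ContDiff ℝ (⊤ : ℕ∞) c)
    (hU : ContDiff ℝ (⊤ : ℕ∞) U) (hV : ContDiff ℝ (⊤ : ℕ∞) V)
    (hW : ContDiff ℝ (⊤ : ℕ∞) W)
    (hU0 : ∀ t, U t ≠ 0) (hV0 : ∀ t, V t ≠ 0) (hW0 : ∀ t, W t ≠ 0)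
    (horder : ∀ x y z, (x, y, z) ∈ Ω → b y < a x ∧ c z < b y)
    (A B C : ℝ → ℝ → ℝ → ℝ)
    (hA : A = fun x y z =>
      U x / (Real.sqrt (a x - b y) * Real.sqrt (a x - c z)))
    (hB : B = fun x y z =>
      V y / ((a x - b y) ^ ((5 : ℝ) / 2) * Real.sqrt (b y - c z)))
    (hC : C = fun x y z =>
      W z / ((a x - c z) ^ ((5 : ℝ) / 2) * Real.sqrt (b y - c z))) :
    ∀ x y z, (x, y, z) ∈ Ω →
      (py (pz A) x y z = (pz B x y z / B x y z) * py A x y z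
          + (py C x y z / C x y z) * pz A x y z) ∧
      (px (pz B) x y z = (pz A x y z / A x y z) * px B x y z
          + (px C x y z / C x y z) * pz B x y z) ∧
      (px (py C) x y z = (py A x y z / A x y z) * px C x y z
          + (px B x y z / B x y z) * py C x y z) := by
  have da : ∀ t, HasDerivAt a (deriv a t) t := fun t =>
    (ha.differentiable (by simp) t).hasDerivAt
  have db : ∀ t, HasDerivAt b (deriv b t) t := fun t =>
    (hb.differentiable (by simp) t).hasDerivAt
  have dc : ∀ t, HasDerivAt c (deriv c t) t := fun t =>
    (hc.differentiable (by simp) t).hasDerivAt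
  have Ay : ∀ x y z, b y < a x →
      HasDerivAt (fun t => A x t z) (A x y z * (deriv b y / (2 * (a x - b y)))) y := by
    intro x y z h
    have hp : 0 < a x - b y := sub_pos.2 h
    subst hA
    refine ((((db y).const_sub (a x)).sqrt_log hp).const_div_mul_const
      (Real.sqrt_pos.2 hp).ne' (U x) (Real.sqrt (a x - c z))).congr_deriv ?_
    ring
  have Az : ∀ x y z, c z < a x →
      HasDerivAt (fun t => A x y t) (A x y z * (deriv c z / (2 * (a x - c z)))) z := by
    intro x y z h
    have hq : 0 < a x - c z := sub_pos.2 h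
    subst hA
    simp only [mul_comm (Real.sqrt (a x - b y))]
    refine ((((dc z).const_sub (a x)).sqrt_log hq).const_div_mul_const
      (Real.sqrt_pos.2 hq).ne' (U x) (Real.sqrt (a x - b y))).congr_deriv ?_
    ring
  have Bx : ∀ x y z, b y < a x →
      HasDerivAt (fun t => B t y z) (B x y z * (-5 * deriv a x / (2 * (a x - b y)))) x := by
    intro x y z h
    have hp : 0 < a x - b y := sub_pos.2 h
    subst hB
    refine ((((da x).sub_const (b y)).rpow_log hp (5 / 2)).const_div_mul_const
      (Real.rpow_pos_of_pos hp _).ne' (V y) (Real.sqrt (b y - c z))).congr_deriv ?_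
    congr 1
    field_simp
  have Bz : ∀ x y z, c z < b y →
      HasDerivAt (fun t => B x y t) (B x y z * (deriv c z / (2 * (b y - c z)))) z := by
    intro x y z h
    have hr : 0 < b y - c z := sub_pos.2 h
    subst hB
    simp only [mul_comm ((a x - b y) ^ ((5 : ℝ) / 2))]
    refine ((((dc z).const_sub (b y)).sqrt_log hr).const_div_mul_const
      (Real.sqrt_pos.2 hr).ne' (V y) ((a x - b y) ^ ((5 : ℝ) / 2))).congr_deriv ?_
    ring
  have Cx : ∀ x y z, c z < a x →
      HasDerivAt (fun t => C t y z) (C x y z * (-5 * deriv a x / (2 * (a x - c z)))) x := by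
    intro x y z h
    have hq : 0 < a x - c z := sub_pos.2 h
    subst hC
    refine ((((da x).sub_const (c z)).rpow_log hq (5 / 2)).const_div_mul_const
      (Real.rpow_pos_of_pos hq _).ne' (W z) (Real.sqrt (b y - c z))).congr_deriv ?_
    congr 1
    field_simp
  have Cy : ∀ x y z, c z < b y →
      HasDerivAt (fun t => C x t z) (C x y z * (-deriv b y / (2 * (b y - c z)))) y := by
    intro x y z h
    have hr : 0 < b y - c z := sub_pos.2 h
    subst hC
    simp only [mul_comm ((a x - c z) ^ ((5 : ℝ) / 2))]
    refine ((((db y).sub_const (c z)).sqrt_log hr).const_div_mul_const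
      (Real.sqrt_pos.2 hr).ne' (W z) ((a x - c z) ^ ((5 : ℝ) / 2))).congr_deriv ?_
    ring
  intro x y z hxyz
  obtain ⟨hba, hcb⟩ := horder x y z hxyz
  have hca : c z < a x := hcb.trans hba
  have hp : 0 < a x - b y := sub_pos.2 hba
  have hq : 0 < a x - c z := sub_pos.2 hca
  have hr : 0 < b y - c z := sub_pos.2 hcb
  have hA0 : A x y z ≠ 0 := by
    subst hA
    exact div_ne_zero (hU0 x) (mul_pos (Real.sqrt_pos.2 hp) (Real.sqrt_pos.2 hq)).ne'
  have hB0 : B x y z ≠ 0 := by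
    subst hB
    exact div_ne_zero (hV0 y) (mul_pos (Real.rpow_pos_of_pos hp _) (Real.sqrt_pos.2 hr)).ne'
  have hC0 : C x y z ≠ 0 := by
    subst hC
    exact div_ne_zero (hW0 z) (mul_pos (Real.rpow_pos_of_pos hq _) (Real.sqrt_pos.2 hr)).ne'
  have Ayz : py (pz A) x y z = A x y z * (deriv b y / (2 * (a x - b y))) *
      (deriv c z / (2 * (a x - c z))) := by
    have hpz : ∀ t, pz A x t z = A x t z * (deriv c z / (2 * (a x - c z))) := fun t =>
      (Az x t z hca).deriv
    simp only [py, hpz]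
    exact ((Ay x y z hba).mul_const _).deriv
  have Bxz : px (pz B) x y z = B x y z * (-5 * deriv a x / (2 * (a x - b y))) *
      (deriv c z / (2 * (b y - c z))) := by
    have hpz : ∀ t, pz B t y z = B t y z * (deriv c z / (2 * (b y - c z))) := fun t =>
      (Bz t y z hcb).deriv
    simp only [px, hpz]
    exact ((Bx x y z hba).mul_const _).deriv
  have Cxy : px (py C) x y z = C x y z * (-5 * deriv a x / (2 * (a x - c z))) *
      (-deriv b y / (2 * (b y - c z))) := by
    have hpy : ∀ t, py C t y z = C t y z * (-deriv b y / (2 * (b y - c z))) := fun t =>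
      (Cy t y z hcb).deriv
    simp only [px, hpy]
    exact ((Cx x y z hca).mul_const _).deriv
  rw [Ayz, Bxz, Cxy]
  simp only [px, py, pz, (Ay x y z hba).deriv, (Az x y z hca).deriv, (Bx x y z hba).deriv,
    (Bz x y z hcb).deriv, (Cx x y z hca).deriv, (Cy x y z hcb).deriv]
  refine ⟨?_, ?_, ?_⟩ <;> field_simp <;> ring
end
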